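/- arXiv:2304.14555 — 2 statements merged into one kernel-verified Lean document; each statement's English description precedes it below -/
import Mathlib

section
/- Let ω be a character of ℚ₃^× with conductor a(ω) = N ≥ 1. If N = 2 and the restriction of ω to ℤ₃^× has order 3, then a(ω) + a(ω²) + a(ω³) = 2N = 4; otherwise a(ω) + a(ω²) + a(ω³) = 3N − 1. -/
noncomputable section

/-- `IsTrivOn p χ n` says that the character `χ` of `ℚ_p^×` is trivial on the subgroup
`U^n`, where `U^0 = ℤ_p^×` and `U^n = 1 + p^n ℤ_p` for `n ≥ 1`. -/
def IsTrivOn (p : ℕ) [Fact p.Prime] (χ : (ℚ_[p])ˣ →* ℂˣ) (n : ℕ) : Prop :=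
  if n = 0 then ∀ u : (ℚ_[p])ˣ, ‖(u : ℚ_[p])‖ = 1 → χ u = 1
  else ∀ u : (ℚ_[p])ˣ, (∃ z : ℤ_[p], (u : ℚ_[p]) = 1 + (p : ℚ_[p]) ^ n * (z : ℚ_[p])) → χ u = 1

/-- The conductor `a(χ)` of a character of `ℚ_p^×`: the smallest `n` such that `χ` is
trivial on `U^n`. -/
def condQ (p : ℕ) [Fact p.Prime] (χ : (ℚ_[p])ˣ →* ℂˣ) : ℕ :=
  sInf {n | IsTrivOn p χ n}

/-- The restriction of a character of `ℚ_p^×` to `ℤ_p^×`. -/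
def restrQ (p : ℕ) [Fact p.Prime] (χ : (ℚ_[p])ˣ →* ℂˣ) : (ℤ_[p])ˣ →* ℂˣ :=
  χ.comp (Units.map (PadicInt.Coe.ringHom.toMonoidHom))

section RestrictionToUnits

variable {p : ℕ} [Fact p.Prime]

/-- The character `ψ` of `ℤ_p^×` is trivial on the units congruent to `1` modulo `p ^ n`. -/
def TrivialModPow (ψ : (ℤ_[p])ˣ →* ℂˣ) (n : ℕ) : Prop :=
  ∀ v : (ℤ_[p])ˣ, (p : ℤ_[p]) ^ n ∣ (v : ℤ_[p]) - 1 → ψ v = 1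

theorem restrQ_pow (χ : (ℚ_[p])ˣ →* ℂˣ) (k : ℕ) : restrQ p (χ ^ k) = restrQ p χ ^ k := rfl

theorem exists_unit_map_eq {u : (ℚ_[p])ˣ} (hu : ‖(u : ℚ_[p])‖ = 1) :
    ∃ v : (ℤ_[p])ˣ, Units.map (PadicInt.Coe.ringHom.toMonoidHom) v = u :=
  ⟨PadicInt.mkUnits hu, Units.ext rfl⟩

theorem isUnit_one_add_p_pow_mul (k : ℕ) (z : ℤ_[p]) :
    IsUnit (1 + (p : ℤ_[p]) ^ (k + 1) * z) := by
  have hmem : (p : ℤ_[p]) ^ (k + 1) * z ∈ IsLocalRing.maximalIdeal ℤ_[p] := by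
    rw [PadicInt.maximalIdeal_eq_span_p, Ideal.mem_span_singleton]
    exact (dvd_pow_self _ k.succ_ne_zero).mul_right z
  have h := IsLocalRing.isUnit_one_sub_self_of_mem_nonunits _ (neg_mem hmem)
  rwa [sub_neg_eq_add] at h

theorem isTrivOn_iff (χ : (ℚ_[p])ˣ →* ℂˣ) (n : ℕ) :
    IsTrivOn p χ n ↔ TrivialModPow (restrQ p χ) n := by
  rcases Nat.eq_zero_or_pos n with rfl | hn
  · simp only [IsTrivOn, TrivialModPow, if_true, pow_zero, isUnit_one, IsUnit.dvd, true_imp_iff]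
    constructor
    · intro h v
      exact h _ (PadicInt.norm_units v)
    · intro h u hu
      obtain ⟨v, rfl⟩ := exists_unit_map_eq hu
      exact h v
  · simp only [IsTrivOn, TrivialModPow, if_neg hn.ne']
    constructor
    · rintro h v ⟨z, hz⟩
      refine h _ ⟨z, ?_⟩
      have hz' : ((v : ℤ_[p]) : ℚ_[p]) = ((1 + (p : ℤ_[p]) ^ n * z : ℤ_[p]) : ℚ_[p]) := by
        rw [← hz, add_sub_cancel]
      exact hz'.trans (by push_cast; rfl)
    · rintro h u ⟨z, hz⟩
      obtain ⟨k, rfl⟩ := Nat.exists_eq_add_of_le' hn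
      obtain ⟨v, hv⟩ := isUnit_one_add_p_pow_mul k z
      have huv : Units.map (PadicInt.Coe.ringHom.toMonoidHom) v = u := by
        ext
        rw [hz]
        change ((v : ℤ_[p]) : ℚ_[p]) = _
        rw [hv]
        push_cast
        rfl
      rw [← huv]
      exact h v ⟨z, by rw [hv]; ring⟩

theorem TrivialModPow.mono {ψ : (ℤ_[p])ˣ →* ℂˣ} {m n : ℕ} (h : TrivialModPow ψ m) (hmn : m ≤ n) :
    TrivialModPow ψ n :=
  fun v hv => h v ((pow_dvd_pow _ hmn).trans hv)

theorem trivialModPow_zero {ψ : (ℤ_[p])ˣ →* ℂˣ} : TrivialModPow ψ 0 ↔ ψ = 1 := by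
  simp [TrivialModPow, MonoidHom.ext_iff]

theorem TrivialModPow.pow {ψ : (ℤ_[p])ˣ →* ℂˣ} {n : ℕ} (h : TrivialModPow ψ n) (k : ℕ) :
    TrivialModPow (ψ ^ k) n :=
  fun v hv => by rw [MonoidHom.pow_apply, h v hv, one_pow]

theorem condQ_le {χ : (ℚ_[p])ˣ →* ℂˣ} {n : ℕ} (h : TrivialModPow (restrQ p χ) n) :
    condQ p χ ≤ n :=
  Nat.sInf_le ((isTrivOn_iff χ n).2 h)

theorem trivialModPow_condQ {χ : (ℚ_[p])ˣ →* ℂˣ} {n : ℕ} (h : TrivialModPow (restrQ p χ) n) :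
    TrivialModPow (restrQ p χ) (condQ p χ) :=
  (isTrivOn_iff χ _).1 (Nat.sInf_mem (s := {n | IsTrivOn p χ n}) ⟨n, (isTrivOn_iff χ n).2 h⟩)

theorem condQ_eq_succ {χ : (ℚ_[p])ˣ →* ℂˣ} {n : ℕ} (h : TrivialModPow (restrQ p χ) (n + 1))
    (h' : ¬ TrivialModPow (restrQ p χ) n) : condQ p χ = n + 1 := by
  refine le_antisymm (condQ_le h) ?_
  by_contra! hlt
  exact h' ((trivialModPow_condQ h).mono (Nat.lt_succ_iff.1 hlt))

end RestrictionToUnits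

theorem three_dvd_unit_sq_sub_one (v : (ℤ_[3])ˣ) :
    (3 : ℤ_[3]) ∣ ((v ^ 2 : (ℤ_[3])ˣ) : ℤ_[3]) - 1 := by
  have key : ∀ x : ZMod 3, IsUnit x → x ^ 2 - 1 = 0 := by decide
  have h : (v : ℤ_[3]) ^ 2 - 1 ∈ RingHom.ker (PadicInt.toZMod (p := 3)) := by
    rw [RingHom.mem_ker, map_sub, map_pow, map_one]
    exact key _ (v.isUnit.map _)
  rw [PadicInt.ker_toZMod, PadicInt.maximalIdeal_eq_span_p, Ideal.mem_span_singleton] at h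
  simpa using h

theorem three_pow_succ_dvd_cube_sub_one {n : ℕ} (hn : 1 ≤ n) {v : (ℤ_[3])ˣ}
    (hv : (3 : ℤ_[3]) ^ n ∣ (v : ℤ_[3]) - 1) :
    (3 : ℤ_[3]) ^ (n + 1) ∣ ((v ^ 3 : (ℤ_[3])ˣ) : ℤ_[3]) - 1 := by
  obtain ⟨z, hz⟩ := hv
  obtain ⟨k, rfl⟩ := Nat.exists_eq_add_of_le' hn
  have hv' : (v : ℤ_[3]) = 1 + 3 ^ (k + 1) * z := by rw [← hz]; ring
  refine ⟨z + 3 ^ (k + 1) * z ^ 2 + 3 ^ (2 * k + 1) * z ^ 3, ?_⟩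
  rw [Units.val_pow_eq_pow_val, hv']
  ring

theorem trivialModPow_of_sq {ψ : (ℤ_[3])ˣ →* ℂˣ} {m n : ℕ} (hm : TrivialModPow ψ m) (hn : 1 ≤ n)
    (h : TrivialModPow (ψ ^ 2) n) : TrivialModPow ψ n := by
  intro v hv
  have hpow : ∀ k : ℕ, (3 : ℤ_[3]) ^ (n + k) ∣ ((v ^ 3 ^ k : (ℤ_[3])ˣ) : ℤ_[3]) - 1 := by
    intro k
    induction k with
    | zero => simpa using hv
    | succ k ih =>
      rw [pow_succ 3 k, pow_mul]
      exact three_pow_succ_dvd_cube_sub_one (n := n + k) (by omega) ih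
  have h3 : ψ v ^ 3 ^ m = 1 := by
    rw [← map_pow]
    exact hm _ ((pow_dvd_pow _ (Nat.le_add_left m n)).trans (mod_cast hpow m))
  have h2 : ψ v ^ 2 = 1 := h v hv
  have hco : Nat.Coprime (3 ^ m) 2 := Nat.Coprime.pow_left m (by norm_num)
  simpa [hco.gcd_eq_one] using pow_gcd_eq_one.2 ⟨h3, h2⟩

theorem trivialModPow_cube {ψ : (ℤ_[3])ˣ →* ℂˣ} {n : ℕ} (hn : 1 ≤ n)
    (h : TrivialModPow ψ (n + 1)) : TrivialModPow (ψ ^ 3) n := by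
  intro v hv
  rw [MonoidHom.pow_apply, ← map_pow]
  exact h _ (mod_cast three_pow_succ_dvd_cube_sub_one hn (mod_cast hv))

/-- One step of successive approximation: a unit congruent to `1` modulo `3 ^ (m + 1)` is, up to
a unit congruent to `1` modulo `3 ^ (m + 2)`, the cube of a unit congruent to `1` modulo `3 ^ m`. -/
theorem exists_cube_approx {m : ℕ} (hm : 1 ≤ m) {v : (ℤ_[3])ˣ}
    (hv : (3 : ℤ_[3]) ^ (m + 1) ∣ (v : ℤ_[3]) - 1) :
    ∃ w : (ℤ_[3])ˣ, (3 : ℤ_[3]) ^ m ∣ (w : ℤ_[3]) - 1 ∧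
      (3 : ℤ_[3]) ^ (m + 2) ∣ ((v / w ^ 3 : (ℤ_[3])ˣ) : ℤ_[3]) - 1 := by
  obtain ⟨z, hz⟩ := hv
  obtain ⟨k, rfl⟩ := Nat.exists_eq_add_of_le' hm
  obtain ⟨w, hw⟩ := isUnit_one_add_p_pow_mul (p := 3) k z
  push_cast at hw
  refine ⟨w, ⟨z, by rw [hw]; ring⟩, ?_⟩
  have hv' : (v : ℤ_[3]) = 1 + 3 ^ (k + 1 + 1) * z := by rw [← hz]; ring
  have hdvd : (3 : ℤ_[3]) ^ (k + 1 + 2) ∣ (v : ℤ_[3]) - (w : ℤ_[3]) ^ 3 := by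
    refine ⟨-(3 ^ k * z ^ 2 + 3 ^ (2 * k) * z ^ 3), ?_⟩
    rw [hv', hw]
    ring
  have hq : ((v / w ^ 3 : (ℤ_[3])ˣ) : ℤ_[3]) - 1 =
      ((v : ℤ_[3]) - (w : ℤ_[3]) ^ 3) * (((w ^ 3)⁻¹ : (ℤ_[3])ˣ) : ℤ_[3]) := by
    rw [sub_mul, div_eq_mul_inv, Units.val_mul, ← Units.val_pow_eq_pow_val, Units.mul_inv]
  rw [hq]
  exact hdvd.mul_right _

theorem trivialModPow_of_cube {ψ : (ℤ_[3])ˣ →* ℂˣ} {m n : ℕ} (hm : TrivialModPow ψ m) (hn : 1 ≤ n)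
    (h : TrivialModPow (ψ ^ 3) n) : TrivialModPow ψ (n + 1) := by
  have step : ∀ l, n ≤ l → TrivialModPow ψ (l + 2) → TrivialModPow ψ (l + 1) := by
    intro l hl hψ v hv
    obtain ⟨w, hw, hvw⟩ := exists_cube_approx (hn.trans hl) (mod_cast hv)
    have h1 := hψ _ (mod_cast hvw)
    have h2 : ψ w ^ 3 = 1 := h.mono hl w (mod_cast hw)
    rwa [map_div, map_pow, h2, div_one] at h1
  have descend : ∀ j, TrivialModPow ψ (n + 1 + j) → TrivialModPow ψ (n + 1) := by
    intro j
    induction j with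
    | zero => exact id
    | succ j ih =>
      exact fun hj => ih ((step (n + j) (by omega) (hj.mono (by omega))).mono (by omega))
  exact descend m (hm.mono (by omega))

/-- For a character `ω` of `ℚ₃^×` of conductor `N ≥ 1`: if `N = 2` and the restriction
of `ω` to `ℤ₃^×` has order `3` then `a(ω) + a(ω²) + a(ω³) = 2N = 4`; otherwise the sum
is `3N - 1`. -/
theorem conductor_sum_principal_series_three (ω : (ℚ_[3])ˣ →* ℂˣ)
    (hfin : ∃ n, IsTrivOn 3 ω n) (N : ℕ) (hN : condQ 3 ω = N) (hN1 : 1 ≤ N) :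
    ((N = 2 ∧ orderOf (restrQ 3 ω) = 3) →
      condQ 3 ω + condQ 3 (ω ^ 2) + condQ 3 (ω ^ 3) = 2 * N) ∧
    (¬(N = 2 ∧ orderOf (restrQ 3 ω) = 3) →
      condQ 3 ω + condQ 3 (ω ^ 2) + condQ 3 (ω ^ 3) = 3 * N - 1) := by
  obtain ⟨n₀, hn₀⟩ := hfin
  have hT : TrivialModPow (restrQ 3 ω) N := hN ▸ trivialModPow_condQ ((isTrivOn_iff ω n₀).1 hn₀)
  have hmin : ∀ m, m < N → ¬ TrivialModPow (restrQ 3 ω) m :=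
    fun m hm h => (hm.trans_le (hN ▸ condQ_le h)).false
  have hne : restrQ 3 ω ≠ 1 := fun h => hmin 0 hN1 (trivialModPow_zero.2 h)
  obtain rfl | ⟨k, rfl⟩ : N = 1 ∨ ∃ k, N = k + 2 := by
    rcases N with _ | _ | k
    · omega
    · exact Or.inl rfl
    · exact Or.inr ⟨k, rfl⟩
  · have hsq : restrQ 3 ω ^ 2 = 1 := by
      ext1 v
      rw [MonoidHom.pow_apply, ← map_pow]
      exact hT _ (by simpa using three_dvd_unit_sq_sub_one v)
    have h2 : condQ 3 (ω ^ 2) = 0 :=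
      Nat.le_zero.1 (condQ_le (by rw [restrQ_pow, hsq, trivialModPow_zero]))
    have hcube : restrQ 3 (ω ^ 3) = restrQ 3 ω := by
      ext1 v
      rw [restrQ_pow, MonoidHom.pow_apply, pow_succ, ← MonoidHom.pow_apply, hsq,
        MonoidHom.one_apply, one_mul]
    have h3 : condQ 3 (ω ^ 3) = 1 :=
      condQ_eq_succ (n := 0) (hcube ▸ hT) (hcube ▸ hmin 0 one_pos)
    omega
  · have h2 : condQ 3 (ω ^ 2) = k + 2 := by
      refine condQ_eq_succ (n := k + 1) ?_ fun h => ?_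
      · rw [restrQ_pow]
        exact hT.pow 2
      · rw [restrQ_pow] at h
        exact hmin (k + 1) (by omega) (trivialModPow_of_sq hT (by omega) h)
    have hT3 : TrivialModPow (restrQ 3 (ω ^ 3)) (k + 1) := by
      rw [restrQ_pow]
      exact trivialModPow_cube (by omega) hT
    by_cases hord : k = 0 ∧ orderOf (restrQ 3 ω) = 3
    · have h3 : condQ 3 (ω ^ 3) = 0 := by
        refine Nat.le_zero.1 (condQ_le (trivialModPow_zero.2 ?_))
        exact orderOf_dvd_iff_pow_eq_one.1 hord.2.dvd
      omega
    · have h3 : condQ 3 (ω ^ 3) = k + 1 := by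
        refine condQ_eq_succ hT3 fun h => ?_
        rw [restrQ_pow] at h
        rcases Nat.eq_zero_or_pos k with rfl | hk
        · exact hord ⟨rfl, orderOf_eq_prime (trivialModPow_zero.1 h) hne⟩
        · exact hmin (k + 1) (by omega) (trivialModPow_of_cube hT hk h)
      omega
end
end

section
/- Let K be a finite field extension of ℚ₂ and χ a character of K^× with conductor a(χ) ≥ 2. Then a(χ²) ≤ a(χ) − 1, and a(χ³) = a(χ). -/
set_option synthInstance.maxHeartbeats 1000000

noncomputable section

instance algebraPadicInt (p : ℕ) [Fact p.Prime] (K : Type*) [Field K] [Algebra ℚ_[p] K] :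
    Algebra ℤ_[p] K :=
  ((algebraMap ℚ_[p] K).comp PadicInt.Coe.ringHom).toAlgebra

/-- The ring of integers `O_K` of a finite extension `K` of `ℚ_p`: the integral closure
of `ℤ_p` in `K`. -/
def ringOfInt (p : ℕ) [Fact p.Prime] (K : Type*) [Field K] [Algebra ℚ_[p] K] :
    Subalgebra ℤ_[p] K :=
  integralClosure ℤ_[p] K

/-- The maximal ideal `m_K` of the local ring `O_K` (its Jacobson radical). -/
def maxIdeal (p : ℕ) [Fact p.Prime] (K : Type*) [Field K] [Algebra ℚ_[p] K] :
    Ideal (ringOfInt p K) :=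
  (⊥ : Ideal (ringOfInt p K)).jacobson

/-- `O_K^×` as a subgroup of `K^×`. -/
def unitsO (p : ℕ) [Fact p.Prime] (K : Type*) [Field K] [Algebra ℚ_[p] K] : Subgroup Kˣ where
  carrier := {u | (u : K) ∈ ringOfInt p K ∧ ((u⁻¹ : Kˣ) : K) ∈ ringOfInt p K}
  one_mem' := ⟨by simpa using (ringOfInt p K).one_mem, by simpa using (ringOfInt p K).one_mem⟩
  mul_mem' := by
    rintro a b ⟨ha1, ha2⟩ ⟨hb1, hb2⟩
    refine ⟨?_, ?_⟩
    · rw [Units.val_mul]; exact mul_mem ha1 hb1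
    · rw [mul_inv, Units.val_mul]; exact mul_mem ha2 hb2
  inv_mem' := by
    rintro a ⟨ha1, ha2⟩
    exact ⟨ha2, by rw [inv_inv]; exact ha1⟩

/-- `IsTrivOnK p K χ n` says that the character `χ` of `K^×` is trivial on the subgroup
`U_K^n`, where `U_K^0 = O_K^×` and `U_K^n = 1 + m_K^n` for `n ≥ 1`. -/
def IsTrivOnK (p : ℕ) [Fact p.Prime] (K : Type*) [Field K] [Algebra ℚ_[p] K]
    (χ : Kˣ →* ℂˣ) (n : ℕ) : Prop :=
  if n = 0 then ∀ u : Kˣ, u ∈ unitsO p K → χ u = 1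
  else ∀ u : Kˣ, (∃ y : ringOfInt p K, y ∈ (maxIdeal p K) ^ n ∧ (u : K) = 1 + (y : K)) → χ u = 1

/-- The conductor `a(χ)` of a character of `K^×`: the smallest `n` such that `χ` is
trivial on `U_K^n`. -/
def condK (p : ℕ) [Fact p.Prime] (K : Type*) [Field K] [Algebra ℚ_[p] K]
    (χ : Kˣ →* ℂˣ) : ℕ :=
  sInf {n | IsTrivOnK p K χ n}

/-- The restriction of a character of `K^×` to `O_K^×`. -/
def restrK (p : ℕ) [Fact p.Prime] (K : Type*) [Field K] [Algebra ℚ_[p] K]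
    (χ : Kˣ →* ℂˣ) : (unitsO p K) →* ℂˣ :=
  χ.comp (unitsO p K).subtype

section

variable {p : ℕ} [Fact p.Prime] {K : Type*} [Field K] [Algebra ℚ_[p] K]

lemma natCast_prime_mem_maxIdeal : (p : ringOfInt p K) ∈ maxIdeal p K := by
  have : Algebra.IsIntegral ℤ_[p] (ringOfInt p K) :=
    inferInstanceAs (Algebra.IsIntegral ℤ_[p] (integralClosure ℤ_[p] K))
  rw [maxIdeal, Ideal.jacobson, Ideal.mem_sInf]
  rintro I ⟨-, hI⟩
  have hmax : (I.comap (algebraMap ℤ_[p] (ringOfInt p K))).IsMaximal :=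
    Ideal.isMaximal_comap_of_isIntegral_of_isMaximal I
  have hp : (p : ℤ_[p]) ∈ I.comap (algebraMap ℤ_[p] (ringOfInt p K)) := by
    rw [IsLocalRing.eq_maximalIdeal hmax]
    exact PadicInt.p_nonunit
  simpa using hp

lemma mem_unitsO_of_eq_one_add {u : Kˣ} {y : ringOfInt p K} (hy : y ∈ maxIdeal p K)
    (hu : (u : K) = 1 + (y : K)) : u ∈ unitsO p K := by
  obtain ⟨v, hv⟩ := (Ideal.mem_jacobson_bot.1 hy 1).exists_right_inv
  have huy : (u : K) = ((y + 1 : ringOfInt p K) : K) := by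
    rw [hu, add_comm]; rfl
  have huv : (u : K) * (v : K) = 1 := by
    rw [huy, ← MulMemClass.coe_mul, ← mul_one y, hv]; rfl
  refine ⟨huy ▸ (y + 1).2, ?_⟩
  rw [Units.inv_eq_of_mul_eq_one_right huv]
  exact v.2

lemma isTrivOnK_of_ne_zero {χ : Kˣ →* ℂˣ} {n : ℕ} (hn : n ≠ 0) :
    IsTrivOnK p K χ n ↔
      ∀ u : Kˣ, ∀ y ∈ maxIdeal p K ^ n, (u : K) = 1 + (y : K) → χ u = 1 := by
  simp only [IsTrivOnK, if_neg hn]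
  exact ⟨fun h u y hy hu => h u ⟨y, hy, hu⟩, fun h u ⟨y, hy, hu⟩ => h u y hy hu⟩

lemma IsTrivOnK.mono {χ : Kˣ →* ℂˣ} {m n : ℕ} (h : IsTrivOnK p K χ m) (hmn : m ≤ n) :
    IsTrivOnK p K χ n := by
  rcases eq_or_ne n 0 with rfl | hn
  · rwa [Nat.le_zero.1 hmn] at h
  rw [isTrivOnK_of_ne_zero hn]
  intro u y hy hu
  rcases eq_or_ne m 0 with rfl | hm
  · rw [IsTrivOnK, if_pos rfl] at h
    exact h u (mem_unitsO_of_eq_one_add (Ideal.pow_le_self hn hy) hu)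
  · exact (isTrivOnK_of_ne_zero hm).1 h u y (Ideal.pow_le_pow_right hmn hy) hu

lemma IsTrivOnK.pow {χ : Kˣ →* ℂˣ} {n : ℕ} (h : IsTrivOnK p K χ n) (k : ℕ) :
    IsTrivOnK p K (χ ^ k) n := by
  unfold IsTrivOnK at h ⊢
  split_ifs at h ⊢ <;> exact fun u hu => by rw [MonoidHom.pow_apply, h u hu, one_pow]

end

lemma IsTrivOnK.sq_of_two {K : Type*} [Field K] [Algebra ℚ_[2] K] {χ : Kˣ →* ℂˣ} {n : ℕ}
    (hn : n ≠ 0) (h : IsTrivOnK 2 K χ (n + 1)) : IsTrivOnK 2 K (χ ^ 2) n := by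
  rw [isTrivOnK_of_ne_zero hn]
  intro u y hy hu
  rw [MonoidHom.pow_apply, ← map_pow]
  refine (isTrivOnK_of_ne_zero n.succ_ne_zero).1 h (u ^ 2) (y * ((2 : ℕ) + y)) ?_ ?_
  · rw [pow_succ]
    exact Ideal.mul_mem_mul hy
      (add_mem natCast_prime_mem_maxIdeal (Ideal.pow_le_self hn hy))
  · have h2 : (((2 : ℕ) : ringOfInt 2 K) : K) = 2 := rfl
    rw [Units.val_pow_eq_pow_val, hu, MulMemClass.coe_mul, AddMemClass.coe_add, h2]
    ring

/-- Let `K` be a finite extension of `ℚ₂` and `χ` a character of `K^×` with conductor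
`a(χ) ≥ 2`.  Then `a(χ²) ≤ a(χ) - 1` and `a(χ³) = a(χ)`. -/
theorem conductor_square_cube_ext_two (K : Type*) [Field K] [Algebra ℚ_[2] K]
    [FiniteDimensional ℚ_[2] K]
    (χ : Kˣ →* ℂˣ) (hfin : ∃ n, IsTrivOnK 2 K χ n) (h2 : 2 ≤ condK 2 K χ) :
    condK 2 K (χ ^ 2) ≤ condK 2 K χ - 1 ∧ condK 2 K (χ ^ 3) = condK 2 K χ := by
  have htriv : IsTrivOnK 2 K χ (condK 2 K χ) := Nat.sInf_mem hfin
  have hsq : IsTrivOnK 2 K (χ ^ 2) (condK 2 K χ - 1) :=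
    IsTrivOnK.sq_of_two (by omega) (by rwa [Nat.sub_add_cancel (by omega)])
  refine ⟨Nat.sInf_le hsq, le_antisymm (Nat.sInf_le (htriv.pow 3)) ?_⟩
  by_contra! hlt
  have hcube : IsTrivOnK 2 K (χ ^ 3) (condK 2 K (χ ^ 3)) :=
    Nat.sInf_mem (s := {n | IsTrivOnK 2 K (χ ^ 3) n}) ⟨_, htriv.pow 3⟩
  have hcube' := hcube.mono (Nat.le_sub_one_of_lt hlt)
  have hχ : IsTrivOnK 2 K χ (condK 2 K χ - 1) := by
    have hne : condK 2 K χ - 1 ≠ 0 := by omega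
    rw [isTrivOnK_of_ne_zero hne] at hsq hcube' ⊢
    intro u y hy hu
    have h₂ := hsq u y hy hu
    have h₃ := hcube' u y hy hu
    rw [MonoidHom.pow_apply] at h₂ h₃
    rwa [pow_succ, h₂, one_mul] at h₃
  have hle : condK 2 K χ ≤ condK 2 K χ - 1 := Nat.sInf_le hχ
  omega
end
end
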